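/- Let X be a real Banach space, let f : X → (−∞,+∞] be proper, lower semicontinuous and convex, and let B : X ⇉ X* be maximal monotone with dom f ∩ int dom B ≠ ∅. Assume dom ∂f ∩ cl(dom B) ⊆ dom B. Then ∂f + B is maximal monotone. -/

import Mathlib

open Set Filter Pointwise

noncomputable section

variable {X : Type*}

abbrev Dual' (X : Type*) [NormedAddCommGroup X] [NormedSpace ℝ X] := X →L[ℝ] ℝ

section Defs
variable [NormedAddCommGroup X] [NormedSpace ℝ X]

/-- `A` is a monotone operator. -/
def MonotoneOp (A : X → Set (Dual' X)) : Prop :=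
  ∀ x y (x' y' : Dual' X), x' ∈ A x → y' ∈ A y → 0 ≤ (x' - y') (x - y)

/-- `A` is maximal monotone: monotone, and every monotonically related pair is in the graph. -/
def MaxMonotone (A : X → Set (Dual' X)) : Prop :=
  MonotoneOp A ∧
    ∀ x (x' : Dual' X), (∀ y y', y' ∈ A y → 0 ≤ (x' - y') (x - y)) → x' ∈ A x

/-- domain of a set-valued operator -/
def domOp (A : X → Set (Dual' X)) : Set X := {x | (A x).Nonempty}

/-- pointwise Minkowski sum of two set-valued operators -/
def opSum (A B : X → Set (Dual' X)) : X → Set (Dual' X) := fun x => A x + B x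

/-- normal cone operator of a set `C` -/
def normalCone (C : Set X) : X → Set (Dual' X) :=
  fun x => {x' | x ∈ C ∧ ∀ c ∈ C, x' (c - x) ≤ 0}

/-- the Fitzpatrick function of `A` -/
def fitz (A : X → Set (Dual' X)) : X × Dual' X → EReal :=
  fun p => ⨆ q ∈ {q : X × Dual' X | q.2 ∈ A q.1},
    ((q.2 p.1 + p.2 q.1 - q.2 q.1 : ℝ) : EReal)

/-- `A` is maximal monotone of type (FPV) -/
def FPV (A : X → Set (Dual' X)) : Prop :=
  MaxMonotone A ∧
    ∀ U : Set X, IsOpen U → Convex ℝ U → (U ∩ domOp A).Nonempty →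
      ∀ x (x' : Dual' X), x ∈ U →
        (∀ y y', y' ∈ A y → y ∈ U → 0 ≤ (x' - y') (x - y)) → x' ∈ A x

/-- `A` is a linear relation: its graph is a linear subspace of `X × X*` -/
def LinearRel (A : X → Set (Dual' X)) : Prop :=
  (0 : Dual' X) ∈ A 0 ∧
  (∀ x y (x' y' : Dual' X), x' ∈ A x → y' ∈ A y → x' + y' ∈ A (x + y)) ∧
  (∀ (c : ℝ) x (x' : Dual' X), x' ∈ A x → c • x' ∈ A (c • x))

/-- subdifferential of an extended-real-valued function -/
def subdiff (f : X → EReal) : X → Set (Dual' X) :=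
  fun x => {x' | ∀ y, ((x' (y - x) : ℝ) : EReal) + f x ≤ f y}

/-- `f` is proper: never `⊥` and not identically `⊤` -/
def ProperFun (f : X → EReal) : Prop := (∀ x, f x ≠ ⊥) ∧ ∃ x, f x ≠ ⊤

/-- convexity for extended-real-valued functions -/
def EConvexOn (f : X → EReal) : Prop :=
  ∀ x y (t : ℝ), 0 ≤ t → t ≤ 1 →
    f (t • x + (1 - t) • y) ≤ (t : EReal) * f x + ((1 - t : ℝ) : EReal) * f y

/-- effective domain of an extended-real-valued function -/
def domFun (f : X → EReal) : Set X := {x | f x ≠ ⊤}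

end Defs

section Convexity
variable [NormedAddCommGroup X] [NormedSpace ℝ X]

lemma exists_pos_add_smul_mem {U : Set X} {x : X} (hU : U ∈ nhds x) (w : X) :
    ∃ δ : ℝ, 0 < δ ∧ x + δ • w ∈ U := by
  have hc : Tendsto (fun δ : ℝ => x + δ • w) (nhds 0) (nhds x) := by
    have : Continuous (fun δ : ℝ => x + δ • w) := by fun_prop
    simpa using this.tendsto 0
  obtain ⟨δ, h1, h2⟩ := (((hc.mono_left nhdsWithin_le_nhds).eventually_mem hU).and
    (self_mem_nhdsWithin (s := Ioi (0 : ℝ)))).exists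
  exact ⟨δ, h2, h1⟩

lemma exists_pos_mem_of_mem_interior {E : Set (X × ℝ)} {p : X × ℝ} (hp : p ∈ interior E) :
    ∃ ε : ℝ, 0 < ε ∧ (p.1, p.2 + ε) ∈ E := by
  obtain ⟨ε, hε, h⟩ := exists_pos_add_smul_mem (mem_interior_iff_mem_nhds.1 hp) ((0 : X), (1 : ℝ))
  refine ⟨ε, hε, ?_⟩
  have e : p + ε • ((0 : X), (1 : ℝ)) = (p.1, p.2 + ε) := by ext <;> simp
  rwa [e] at h

lemma clm_prod_apply (F : X × ℝ →L[ℝ] ℝ) (q : X × ℝ) :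
    F q = F.comp (ContinuousLinearMap.inl ℝ X ℝ) q.1 + q.2 * F (0, 1) := by
  have e : q = (q.1, 0) + q.2 • ((0 : X), (1 : ℝ)) := by ext <;> simp
  conv_lhs => rw [e, map_add, map_smul]
  simp

/-- A convex set of epigraph type and a convex set of hypograph type are separated by the
graph of a continuous affine function, under a qualification condition. -/
lemma exists_affine_between {E₁ E₂ : Set (X × ℝ)} (h₁ : Convex ℝ E₁) (h₂ : Convex ℝ E₂)
    (hdown : ∀ x s t, (x, s) ∈ E₂ → t ≤ s → (x, t) ∈ E₂) (hint : (interior E₂).Nonempty)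
    (hdisj : Disjoint (interior E₂) E₁) {p : X × ℝ} (hp : p ∈ E₁)
    (hp' : p.1 ∈ interior (Prod.fst '' E₂)) :
    ∃ (a : X →L[ℝ] ℝ) (c : ℝ), (∀ q ∈ E₁, a q.1 + c ≤ q.2) ∧ ∀ q ∈ E₂, q.2 ≤ a q.1 + c := by
  obtain ⟨F, u, hF₂, hF₁⟩ := geometric_hahn_banach_open h₂.interior isOpen_interior h₁ hdisj
  have hF₂' : ∀ q ∈ E₂, F q ≤ u := by
    intro q hq
    have hq' : q ∈ closure (interior E₂) := by
      rw [h₂.closure_interior_eq_closure_of_nonempty_interior hint]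
      exact subset_closure hq
    exact closure_minimal (fun a ha => (hF₂ a ha).le)
      (isClosed_le F.continuous continuous_const) hq'
  set ψ := F.comp (ContinuousLinearMap.inl ℝ X ℝ) with hψ
  set σ := F (0, 1) with hσ
  have hF : ∀ q, F q = ψ q.1 + q.2 * σ := clm_prod_apply F
  obtain ⟨q₀, hq₀⟩ := hint
  have hσ0 : 0 ≤ σ := by
    by_contra! hneg
    have hq := interior_subset hq₀
    have h1 := hF₂' _ (hdown q₀.1 q₀.2 (min q₀.2 ((u + 1 - ψ q₀.1) / σ)) hq (min_le_left _ _))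
    rw [hF] at h1
    have h2 : (u + 1 - ψ q₀.1) / σ * σ ≤ min q₀.2 ((u + 1 - ψ q₀.1) / σ) * σ :=
      mul_le_mul_of_nonpos_right (min_le_right _ _) hneg.le
    rw [div_mul_cancel₀ _ hneg.ne] at h2
    simp only at h1
    linarith
  have hσ1 : 0 < σ := by
    refine lt_of_le_of_ne hσ0 fun h0 => ?_
    obtain ⟨δ, hδ, q, hq, hqe⟩ :=
      exists_pos_add_smul_mem (mem_interior_iff_mem_nhds.1 hp') (p.1 - q₀.1)
    have h1 := hF₂' q hq
    have h2 := hF₁ p hp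
    have h3 := hF₂ q₀ hq₀
    rw [hF, ← h0] at h1 h2 h3
    rw [hqe, map_add, map_smul, map_sub, smul_eq_mul] at h1
    nlinarith
  refine ⟨-σ⁻¹ • ψ, u / σ, fun q hq => ?_, fun q hq => ?_⟩
  · have h := hF₁ q hq
    rw [hF] at h
    have : (-σ⁻¹ • ψ) q.1 + u / σ = (u - ψ q.1) / σ := by
      simp only [smul_apply, smul_eq_mul]; ring
    rw [this, div_le_iff₀ hσ1]; linarith
  · have h := hF₂' q hq
    rw [hF] at h
    have : (-σ⁻¹ • ψ) q.1 + u / σ = (u - ψ q.1) / σ := by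
      simp only [smul_apply, smul_eq_mul]; ring
    rw [this, le_div_iff₀ hσ1]; linarith

/-- A convex function with closed epigraph has a continuous affine minorant. -/
lemma exists_affine_minorant {Q : Set X} {g : X → ℝ} (hg : ConvexOn ℝ Q g)
    (hcl : IsClosed {p : X × ℝ | p.1 ∈ Q ∧ g p.1 ≤ p.2}) (hQ : Q.Nonempty) :
    ∃ (a : X →L[ℝ] ℝ) (c : ℝ), ∀ w ∈ Q, a w + c ≤ g w := by
  obtain ⟨x, hx⟩ := hQ
  have hn : ((x, g x - 1) : X × ℝ) ∉ {p : X × ℝ | p.1 ∈ Q ∧ g p.1 ≤ p.2} := by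
    rintro ⟨-, h⟩
    simp only at h
    linarith
  obtain ⟨F, u, h1, h2⟩ := geometric_hahn_banach_point_closed hg.convex_epigraph hcl hn
  set ψ := F.comp (ContinuousLinearMap.inl ℝ X ℝ) with hψ
  set σ := F (0, 1) with hσ
  have hF : ∀ q, F q = ψ q.1 + q.2 * σ := clm_prod_apply F
  have h3 := h2 (x, g x) ⟨hx, le_rfl⟩
  rw [hF] at h1 h3
  simp only at h1 h3
  have hσ1 : 0 < σ := by nlinarith
  refine ⟨-σ⁻¹ • ψ, u / σ, fun w hw => ?_⟩
  have h := h2 (w, g w) ⟨hw, le_rfl⟩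
  rw [hF] at h
  have : (-σ⁻¹ • ψ) w + u / σ = (u - ψ w) / σ := by
    simp only [smul_apply, smul_eq_mul]; ring
  rw [this, div_le_iff₀ hσ1]
  simp only at h
  linarith

/-- Fermat's rule for the sum of a convex function `g` on `Q` and a continuous convex function
`h` restricted to a convex set `C` meeting the qualification condition. -/
lemma exists_subgradient_split {Q C : Set X} {g h : X → ℝ} (hg : ConvexOn ℝ Q g)
    (hh : ConvexOn ℝ C h) (hhc : Continuous h) {x₀ y : X} (hx₀ : x₀ ∈ Q)
    (hx₀' : x₀ ∈ interior C) (hy : y ∈ Q) (hyC : y ∈ C)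
    (hmin : ∀ w ∈ Q, w ∈ C → g y + h y ≤ g w + h w) :
    ∃ a : X →L[ℝ] ℝ, (∀ w ∈ Q, g y + a (w - y) ≤ g w) ∧ ∀ w ∈ C, h y ≤ h w + a (w - y) := by
  set m := g y + h y with hm
  have hopen : IsOpen {p : X × ℝ | p.1 ∈ interior C ∧ p.2 < m - h p.1} :=
    (isOpen_interior.preimage continuous_fst).inter
      (isOpen_lt continuous_snd (continuous_const.sub (hhc.comp continuous_fst)))
  have hsub : {p : X × ℝ | p.1 ∈ interior C ∧ p.2 < m - h p.1} ⊆
      {p : X × ℝ | p.1 ∈ C ∧ p.2 ≤ m - h p.1} := fun p hp => ⟨interior_subset hp.1, hp.2.le⟩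
  have hconc : ConcaveOn ℝ C (fun x => m - h x) := (concaveOn_const m hh.1).sub hh
  obtain ⟨a, c, ha, hc⟩ := exists_affine_between hg.convex_epigraph hconc.convex_hypograph
    (fun x s t hs hts => ⟨hs.1, hts.trans hs.2⟩)
    ⟨(x₀, m - h x₀ - 1), interior_maximal hsub hopen ⟨hx₀', by simp⟩⟩
    (Set.disjoint_left.2 fun p hp hp' => by
      obtain ⟨ε, hε, h1⟩ := exists_pos_mem_of_mem_interior hp
      have h2 := hmin p.1 hp'.1 h1.1
      have h3 := hp'.2
      have h4 := h1.2
      simp only at h4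
      linarith)
    (p := (x₀, g x₀)) ⟨hx₀, le_rfl⟩
    (interior_mono (fun x hx => mem_image_of_mem Prod.fst
      (show (x, m - h x) ∈ {p : X × ℝ | p.1 ∈ C ∧ p.2 ≤ m - h p.1} from ⟨hx, le_rfl⟩)) hx₀')
  have h1 := ha (y, g y) ⟨hy, le_rfl⟩
  have h2 := hc (y, m - h y) ⟨hyC, le_rfl⟩
  simp only at h1 h2
  refine ⟨a, fun w hw => ?_, fun w hw => ?_⟩
  · have h3 := ha (w, g w) ⟨hw, le_rfl⟩
    simp only at h3
    rw [map_sub]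
    linarith
  · have h3 := hc (w, m - h w) ⟨hw, le_rfl⟩
    simp only at h3
    rw [map_sub]
    linarith

lemma exists_subgradient_sum {Q C : Set X} {g h : X → ℝ} (hg : ConvexOn ℝ Q g)
    (hC : Convex ℝ C) (hh : ConvexOn ℝ univ h) (hhc : Continuous h) {x₀ y : X} (hx₀ : x₀ ∈ Q)
    (hx₀' : x₀ ∈ interior C) (hy : y ∈ Q) (hyC : y ∈ C)
    (hmin : ∀ w ∈ Q, w ∈ C → g y + h y ≤ g w + h w) :
    ∃ a c : X →L[ℝ] ℝ, (∀ w ∈ Q, g y + a (w - y) ≤ g w) ∧ (∀ w ∈ C, c (w - y) ≤ 0) ∧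
      ∀ w, h y ≤ h w + (a + c) (w - y) := by
  obtain ⟨a, ha, hah⟩ := exists_subgradient_split hg (hh.subset (subset_univ C) hC) hhc hx₀ hx₀'
    hy hyC hmin
  obtain ⟨c, hc, hch⟩ := exists_subgradient_split (g := fun _ => 0) (h := fun w => h w + a w)
    (convexOn_const 0 hC) (hh.add (a.toLinearMap.convexOn convex_univ))
    (hhc.add a.continuous) hyC (by simp) hyC (mem_univ y) (fun w hw _ => by
      have := hah w hw
      rw [map_sub] at this
      linarith)
  refine ⟨a, c, ha, fun w hw => by simpa using hc w hw, fun w => ?_⟩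
  have := hch w (mem_univ w)
  rw [add_apply, map_sub a]
  linarith

end Convexity

section Ekeland
variable [NormedAddCommGroup X]

lemma exists_half_descent {Q : Set X} {G : X → ℝ} {m : ℝ} (hm : ∀ w ∈ Q, m ≤ G w) {p : X}
    (hp : p ∈ Q) :
    ∃ p' ∈ Q, G p' + ‖p' - p‖ ≤ G p ∧
      ∀ q ∈ Q, G q + ‖q - p‖ ≤ G p → G p' ≤ (G p + G q) / 2 := by
  set S := {q | q ∈ Q ∧ G q + ‖q - p‖ ≤ G p} with hS
  have hpS : p ∈ S := ⟨hp, by simp⟩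
  have hbdd : BddBelow (G '' S) := ⟨m, by rintro _ ⟨q, hq, rfl⟩; exact hm q hq.1⟩
  have hle : ∀ q ∈ S, sInf (G '' S) ≤ G q := fun q hq => csInf_le hbdd ⟨q, hq, rfl⟩
  rcases (hle p hpS).eq_or_lt with h | h
  · refine ⟨p, hp, hpS.2, fun q hq hqp => ?_⟩
    have := hle q ⟨hq, hqp⟩
    linarith
  · obtain ⟨_, ⟨p', hp', rfl⟩, hlt⟩ := exists_lt_of_csInf_lt (s := G '' S)
      ⟨_, p, hpS, rfl⟩ (show sInf (G '' S) < (G p + sInf (G '' S)) / 2 by linarith)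
    refine ⟨p', hp'.1, hp'.2, fun q hq hqp => ?_⟩
    have := hle q ⟨hq, hqp⟩
    linarith

/-- Ekeland's variational principle for a function with closed epigraph over `Q`. -/
lemma ekeland [CompleteSpace X] {Q : Set X} {G : X → ℝ} {m : ℝ} (hm : ∀ w ∈ Q, m ≤ G w)
    (hcl : IsClosed {p : X × ℝ | p.1 ∈ Q ∧ G p.1 ≤ p.2}) {x : X} (hx : x ∈ Q) :
    ∃ y ∈ Q, G y ≤ G x ∧ ∀ w ∈ Q, G y ≤ G w + ‖w - y‖ := by
  choose! next hnQ hnd hnh using fun p (hp : p ∈ Q) => exists_half_descent hm hp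
  set u : ℕ → X := fun n => next^[n] x with hu
  have hus : ∀ n, u (n + 1) = next (u n) := fun n => Function.iterate_succ_apply' next n x
  have huQ : ∀ n, u n ∈ Q := by
    intro n
    induction n with
    | zero => exact hx
    | succ n ih => rw [hus]; exact hnQ _ ih
  have hstep : ∀ n k, G (u (n + k)) + ‖u (n + k) - u n‖ ≤ G (u n) := by
    intro n k
    induction k with
    | zero => simp
    | succ k ih =>
      have h1 := hnd _ (huQ (n + k))
      rw [← hus] at h1
      have h2 := norm_sub_le_norm_sub_add_norm_sub (u (n + k + 1)) (u (n + k)) (u n)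
      rw [← add_assoc]
      linarith
  have hanti : Antitone (fun n => G (u n)) := antitone_nat_of_succ_le fun n => by
    have := hstep n 1
    have := norm_nonneg (u (n + 1) - u n)
    linarith
  have hbdd : BddBelow (range fun n => G (u n)) :=
    ⟨m, by rintro _ ⟨n, rfl⟩; exact hm _ (huQ n)⟩
  obtain ⟨l, hl⟩ : ∃ l, Tendsto (fun n => G (u n)) atTop (nhds l) :=
    ⟨_, tendsto_atTop_ciInf hanti hbdd⟩
  have hll : ∀ n, l ≤ G (u n) := fun n => hanti.le_of_tendsto hl n
  have hcau : CauchySeq u := by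
    refine cauchySeq_of_le_tendsto_0' (fun n => G (u n) - l) (fun n k hnk => ?_)
      (by simpa using hl.sub_const l)
    obtain ⟨j, rfl⟩ := Nat.exists_eq_add_of_le hnk
    have h1 := hstep n j
    have h2 := hll (n + j)
    rw [dist_comm, dist_eq_norm]
    linarith
  obtain ⟨y, hy⟩ := cauchySeq_tendsto_of_complete hcau
  obtain ⟨hyQ, hyl⟩ : y ∈ Q ∧ G y ≤ l :=
    hcl.mem_of_tendsto (hy.prodMk_nhds hl) (Eventually.of_forall fun n => ⟨huQ n, le_rfl⟩)
  have hyu : ∀ n, G y + ‖y - u n‖ ≤ G (u n) := by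
    intro n
    have h1 : Tendsto (fun k => G (u (k + n)) + ‖u (k + n) - u n‖) atTop
        (nhds (l + ‖y - u n‖)) :=
      ((tendsto_add_atTop_iff_nat n).2 hl).add
        (((tendsto_add_atTop_iff_nat n).2 hy).sub_const (u n)).norm
    have h2 := le_of_tendsto' h1 fun k => by rw [add_comm k n]; exact hstep n k
    linarith
  refine ⟨y, hyQ, hyl.trans (hll 0), fun q hq => ?_⟩
  by_contra! hlt
  have hqu : ∀ n, G q + ‖q - u n‖ ≤ G (u n) := fun n => by
    have h1 := hyu n
    have h2 := norm_sub_le_norm_sub_add_norm_sub q y (u n)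
    linarith
  have h1 : ∀ n, G (u (n + 1)) ≤ (G (u n) + G q) / 2 := fun n => by
    rw [hus]; exact hnh _ (huQ n) q hq (hqu n)
  have h2 := le_of_tendsto_of_tendsto' ((tendsto_add_atTop_iff_nat 1).2 hl)
    ((hl.add_const (G q)).div_const 2) h1
  have h3 := norm_nonneg (q - y)
  linarith

lemma mem_and_le_of_forall_near {Q : Set X} {g : X → ℝ} {z : X}
    (hcl : IsClosed {p : X × ℝ | p.1 ∈ Q ∧ g p.1 ≤ p.2}) {A : ℝ}
    (h : ∀ ε > 0, ∃ y ∈ Q, ‖y - z‖ < ε ∧ g y < A + ε) : z ∈ Q ∧ g z ≤ A := by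
  refine hcl.closure_subset (a := (z, A)) (Metric.mem_closure_iff.2 fun ε hε => ?_)
  obtain ⟨y, hy, hyz, hyA⟩ := h ε hε
  refine ⟨(y, max (g y) A), ⟨hy, le_max_left _ _⟩, ?_⟩
  rw [Prod.dist_eq, max_lt_iff, dist_comm, dist_eq_norm, dist_comm, Real.dist_eq]
  refine ⟨hyz, ?_⟩
  rw [abs_of_nonneg (sub_nonneg.2 (le_max_right _ _)), sub_lt_iff_lt_add', max_lt_iff]
  exact ⟨hyA, by linarith⟩

lemma exists_small_bound (a b : ℝ) {ε : ℝ} (hε : 0 < ε) : ∃ ρ > 0, ρ * |a| < ε ∧ ρ * |b| < ε := by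
  refine ⟨ε / (|a| + |b| + 1), by positivity, ?_, ?_⟩ <;>
  · rw [div_mul_eq_mul_div, div_lt_iff₀ (by positivity)]
    nlinarith [abs_nonneg a, abs_nonneg b]

end Ekeland

section Fitzpatrick
variable [NormedAddCommGroup X] [NormedSpace ℝ X] {B : X → Set (Dual' X)}

/-- The projection onto `X × ℝ` of the hypograph of `(x, u) ↦ u z - F_B (x, u)`, with `F_B` the
Fitzpatrick function of `B`. -/
def fitzHypo (B : X → Set (Dual' X)) (z : X) : Set (X × ℝ) :=
  {p | ∃ u : Dual' X, ∀ y, ∀ v ∈ B y, p.2 ≤ u (z - y) - v (p.1 - y)}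

lemma convex_fitzHypo (B : X → Set (Dual' X)) (z : X) : Convex ℝ (fitzHypo B z) := by
  rintro p ⟨u, hu⟩ q ⟨w, hw⟩ α β hα hβ hαβ
  refine ⟨α • u + β • w, fun y v hv => ?_⟩
  have h1 := mul_le_mul_of_nonneg_left (hu y v hv) hα
  have h2 := mul_le_mul_of_nonneg_left (hw y v hv) hβ
  have e : (α • p + β • q).1 - y = α • (p.1 - y) + β • (q.1 - y) := by
    have : y = (α + β) • y := by rw [hαβ, one_smul]
    nth_rewrite 1 [this]
    simp only [Prod.fst_add, Prod.smul_fst]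
    module
  rw [e]
  simp only [Prod.snd_add, Prod.smul_snd, add_apply, smul_apply, smul_eq_mul, map_add, map_smul]
  linarith

lemma fitzHypo_down {z x : X} {s t : ℝ} (h : (x, s) ∈ fitzHypo B z) (hts : t ≤ s) :
    (x, t) ∈ fitzHypo B z := by
  obtain ⟨u, hu⟩ := h
  exact ⟨u, fun y v hv => hts.trans (hu y v hv)⟩

lemma MonotoneOp.mem_fitzHypo (hB : MonotoneOp B) {y : X} {v : Dual' X} (hv : v ∈ B y) (z : X) :
    (y, v (z - y)) ∈ fitzHypo B z := by
  refine ⟨v, fun w v' hv' => ?_⟩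
  have := hB y w v v' hv hv'
  simp only [sub_apply, map_sub] at *
  linarith

lemma MonotoneOp.domOp_subset (hB : MonotoneOp B) (z : X) :
    domOp B ⊆ Prod.fst '' fitzHypo B z := fun _ ⟨_, hv⟩ => ⟨_, hB.mem_fitzHypo hv z, rfl⟩

lemma locally_bounded [CompleteSpace X] {z x : X}
    (hx : x ∈ interior (Prod.fst '' fitzHypo B z)) :
    ∃ r K : ℝ, 0 < r ∧ 0 ≤ K ∧ ∀ y, ‖y - x‖ < r → ∀ v ∈ B y, ‖v‖ ≤ K := by
  let ι := {q : X × Dual' X // q.2 ∈ B q.1 ∧ ‖q.1 - x‖ ≤ 1}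
  let T : ι → X →L[ℝ] ℝ := fun q => (1 + ‖q.1.2‖ * ‖q.1.1 - x‖)⁻¹ • q.1.2
  have hpos : ∀ q : ι, 0 < 1 + ‖q.1.2‖ * ‖q.1.1 - x‖ := fun q => by positivity
  have hone : ∀ w : X, ∃ C, ∀ q : ι, T q w ≤ C := by
    intro w
    obtain ⟨δ, hδ, ⟨_, s⟩, ⟨u, hu⟩, rfl⟩ :=
      exists_pos_add_smul_mem (mem_interior_iff_mem_nhds.1 hx) w
    refine ⟨(‖u‖ * (‖z - x‖ + 1) + |s| + 1) / δ, fun ⟨⟨y, v⟩, hv, hy⟩ => ?_⟩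
    have h1 := hu y v hv
    have h2 : v (x + δ • w - y) = δ * v w - v (y - x) := by
      simp only [map_sub, map_add, map_smul, smul_eq_mul]; ring
    have h3 : u (z - y) ≤ ‖u‖ * (‖z - x‖ + 1) := by
      refine (le_abs_self _).trans ((u.le_opNorm _).trans ?_)
      have := norm_sub_le_norm_sub_add_norm_sub z x y
      rw [norm_sub_rev x y] at this
      gcongr
      linarith
    have h4 : v (y - x) ≤ ‖v‖ * ‖y - x‖ := (le_abs_self _).trans (v.le_opNorm _)
    have h5 : 0 ≤ ‖v‖ * ‖y - x‖ := by positivity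
    have h6 : 0 ≤ ‖u‖ * (‖z - x‖ + 1) := by positivity
    have h7 := neg_abs_le s
    have h8 := abs_nonneg s
    simp only [T, smul_apply, smul_eq_mul]
    rw [inv_mul_le_iff₀ (by positivity), mul_div_assoc', le_div_iff₀ hδ]
    simp only at h1
    nlinarith
  obtain ⟨K, hK⟩ := banach_steinhaus (g := T) fun w => by
    obtain ⟨C₁, h₁⟩ := hone w
    obtain ⟨C₂, h₂⟩ := hone (-w)
    refine ⟨max C₁ C₂, fun q => ?_⟩
    rw [Real.norm_eq_abs, abs_le']
    exact ⟨(h₁ q).trans (le_max_left _ _), by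
      rw [← map_neg]; exact (h₂ q).trans (le_max_right _ _)⟩
  set K' := max K 1 with hK'
  have hK1 : 1 ≤ K' := le_max_right _ _
  refine ⟨1 / (2 * K'), 2 * K', by positivity, by positivity, fun y hy v hv => ?_⟩
  rw [lt_div_iff₀ (by positivity)] at hy
  have hy1 : ‖y - x‖ ≤ 1 := by nlinarith [norm_nonneg (y - x)]
  have h := (hK ⟨(y, v), hv, hy1⟩).trans (le_max_left K 1)
  have hp := hpos ⟨(y, v), hv, hy1⟩
  simp only [T, norm_smul, norm_inv, Real.norm_eq_abs, abs_of_pos hp] at h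
  rw [inv_mul_le_iff₀ hp] at h
  simp only at h
  rw [← hK'] at h
  nlinarith [norm_nonneg v]

lemma MonotoneOp.interior_fitzHypo_nonempty [CompleteSpace X] (hB : MonotoneOp B)
    (hint : (interior (domOp B)).Nonempty) (z : X) : (interior (fitzHypo B z)).Nonempty := by
  obtain ⟨x, hx⟩ := hint
  obtain ⟨r, K, hr, hK0, hK⟩ := locally_bounded (interior_mono (hB.domOp_subset z) hx)
  obtain ⟨ρ, hρ, hball⟩ := Metric.mem_nhds_iff.1 (mem_interior_iff_mem_nhds.1 hx)
  set δ := min r ρ with hδ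
  have hδ0 : 0 < δ := lt_min hr hρ
  refine ⟨(x, -(K * (‖z - x‖ + δ)) - 1), interior_maximal (t := Metric.ball x δ ×ˢ
    Iio (-(K * (‖z - x‖ + δ)))) ?_ (Metric.isOpen_ball.prod isOpen_Iio)
    ⟨Metric.mem_ball_self hδ0, by simp⟩⟩
  rintro ⟨y, s⟩ ⟨hy, hs⟩
  rw [mem_ball_iff_norm] at hy
  obtain ⟨v, hv⟩ := hball (mem_ball_iff_norm.2 (hy.trans_le (min_le_right _ _)))
  refine fitzHypo_down (hB.mem_fitzHypo hv z) ((le_of_lt hs).trans ?_)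
  have h1 := hK y (hy.trans_le (min_le_left _ _)) v hv
  have h2 := neg_le_of_abs_le ((v.le_opNorm (z - y)).trans
    (mul_le_mul_of_nonneg_right h1 (norm_nonneg _)))
  have h3 := norm_sub_le_norm_sub_add_norm_sub z x y
  rw [norm_sub_rev x y] at h3
  nlinarith

lemma MaxMonotone.neg_mem (hB : MaxMonotone B) {z : X} {a : Dual' X} {c : ℝ} (hc : a z + c ≤ 0)
    (h : ∀ q ∈ fitzHypo B z, q.2 ≤ a q.1 + c) : -a ∈ B z := by
  refine hB.2 z (-a) fun y v hv => ?_
  have := h _ (hB.1.mem_fitzHypo hv z)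
  simp only [sub_apply, neg_apply, map_sub] at *
  linarith

lemma MaxMonotone.le_zero_of_mem_fitzHypo (hB : MaxMonotone B) {z : X} {s : ℝ}
    (h : (z, s) ∈ fitzHypo B z) : s ≤ 0 := by
  obtain ⟨u, hu⟩ := h
  by_contra! hs
  have : u ∈ B z := hB.2 z u fun y v hv => by
    have := hu y v hv
    simp only [sub_apply] at *
    linarith
  have := hu z u this
  simp only [sub_self, map_zero] at this
  linarith

lemma MaxMonotone.interior_subset_domOp [CompleteSpace X] (hB : MaxMonotone B)
    (hint : (interior (domOp B)).Nonempty) (z₀ : X) :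
    interior (Prod.fst '' fitzHypo B z₀) ⊆ domOp B := by
  intro z hz
  have hz' : z ∈ interior (Prod.fst '' fitzHypo B z) := by
    refine interior_mono ?_ hz
    rintro _ ⟨⟨x, s⟩, ⟨u, hu⟩, rfl⟩
    refine ⟨(x, s + u (z - z₀)), ⟨u, fun y v hv => ?_⟩, rfl⟩
    have := hu y v hv
    simp only [map_sub] at *
    linarith
  obtain ⟨a, c, h1, h2⟩ := exists_affine_between (convex_singleton ((z, 0) : X × ℝ))
    (convex_fitzHypo B z) (fun _ _ _ h => fitzHypo_down h)
    (hB.1.interior_fitzHypo_nonempty hint z)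
    (Set.disjoint_singleton_right.2 fun hp => by
      obtain ⟨ε, hε, h⟩ := exists_pos_mem_of_mem_interior hp
      have := hB.le_zero_of_mem_fitzHypo h
      linarith) rfl hz'
  exact ⟨-a, hB.neg_mem (h1 _ rfl) h2⟩

lemma MaxMonotone.closure_domOp [CompleteSpace X] (hB : MaxMonotone B)
    (hint : (interior (domOp B)).Nonempty) (z : X) :
    closure (domOp B) = closure (Prod.fst '' fitzHypo B z) := by
  refine (closure_mono (hB.1.domOp_subset z)).antisymm ?_
  have hc : Convex ℝ (Prod.fst '' fitzHypo B z) :=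
    (convex_fitzHypo B z).linear_image (LinearMap.fst ℝ X ℝ)
  rw [← hc.closure_interior_eq_closure_of_nonempty_interior
    (hint.mono (interior_mono (hB.1.domOp_subset z)))]
  exact closure_mono (hB.interior_subset_domOp hint z)

lemma MaxMonotone.convex_closure_domOp [CompleteSpace X] (hB : MaxMonotone B)
    (hint : (interior (domOp B)).Nonempty) : Convex ℝ (closure (domOp B)) := by
  rw [hB.closure_domOp hint 0]
  exact ((convex_fitzHypo B 0).linear_image (LinearMap.fst ℝ X ℝ)).closure

lemma MaxMonotone.interior_closure_domOp [CompleteSpace X] (hB : MaxMonotone B)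
    (hint : (interior (domOp B)).Nonempty) (z : X) :
    interior (closure (domOp B)) = interior (Prod.fst '' fitzHypo B z) := by
  rw [hB.closure_domOp hint z]
  exact ((convex_fitzHypo B z).linear_image
    (LinearMap.fst ℝ X ℝ)).interior_closure_eq_interior_of_nonempty_interior
    (hint.mono (interior_mono (hB.1.domOp_subset z)))

lemma MaxMonotone.add_mem (hB : MaxMonotone B) {y : X} {b c : Dual' X} (hb : b ∈ B y)
    (hc : ∀ w ∈ closure (domOp B), c (w - y) ≤ 0) : b + c ∈ B y := by
  refine hB.2 y _ fun w v hv => ?_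
  have h1 := hB.1 y w b v hb hv
  have h2 := hc w (subset_closure ⟨v, hv⟩)
  simp only [sub_apply, add_apply, map_sub] at *
  linarith

end Fitzpatrick

section Core
variable [NormedAddCommGroup X] [NormedSpace ℝ X]

/-- The infimal convolution of `n‖·‖` with the linear penalty `M * l` along the segment
`{p + l • v | 0 ≤ l ≤ 1}`. -/
lemma exists_segment_penalty (p v : X) {n : ℝ} (hn : 0 ≤ n) (M : ℝ) :
    ∃ h : X → ℝ, (∀ w, ∀ l ∈ Icc (0 : ℝ) 1, h w ≤ n * ‖w - p - l • v‖ + M * l) ∧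
      (∀ w, ∃ l ∈ Icc (0 : ℝ) 1, h w = n * ‖w - p - l • v‖ + M * l) ∧
      ConvexOn ℝ univ h ∧ Continuous h := by
  have hex : ∀ w, ∃ l ∈ Icc (0 : ℝ) 1, ∀ l' ∈ Icc (0 : ℝ) 1,
      n * ‖w - p - l • v‖ + M * l ≤ n * ‖w - p - l' • v‖ + M * l' := fun w =>
    isCompact_Icc.exists_isMinOn (nonempty_Icc.2 zero_le_one)
      (f := fun l : ℝ => n * ‖w - p - l • v‖ + M * l) (by fun_prop)
  choose l hl hmin using hex
  refine ⟨fun w => n * ‖w - p - l w • v‖ + M * l w, fun w => hmin w, fun w => ⟨l w, hl w, rfl⟩,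
    ⟨convex_univ, fun w _ w' _ α β hα hβ hαβ => ?_⟩, ?_⟩
  · refine (hmin _ (α • l w + β • l w') (convex_Icc 0 1 (hl w) (hl w') hα hβ hαβ)).trans ?_
    have e : α • w + β • w' - p - (α • l w + β • l w') • v =
        α • (w - p - l w • v) + β • (w' - p - l w' • v) := by
      have : p = (α + β) • p := by rw [hαβ, one_smul]
      nth_rewrite 1 [this]
      simp only [smul_eq_mul]
      module
    have h1 := norm_add_le (α • (w - p - l w • v)) (β • (w' - p - l w' • v))
    rw [← e, norm_smul, norm_smul, Real.norm_of_nonneg hα, Real.norm_of_nonneg hβ] at h1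
    have h2 := mul_le_mul_of_nonneg_left h1 hn
    simp only [smul_eq_mul] at *
    linarith
  · refine (LipschitzWith.of_le_add_mul ⟨n, hn⟩ fun w w' => ?_).continuous
    refine (hmin w (l w') (hl w')).trans ?_
    have h1 : ‖w - p - l w' • v‖ ≤ ‖w' - p - l w' • v‖ + dist w w' := by
      rw [dist_eq_norm]
      have := norm_add_le (w' - p - l w' • v) (w - w')
      rwa [show w' - p - l w' • v + (w - w') = w - p - l w' • v by abel] at this
    have h2 := mul_le_mul_of_nonneg_left h1 hn
    change _ ≤ _ + n * _
    linarith

lemma MonotoneOp.apply_le_of_near_segment {B : X → Set (Dual' X)} (hB : MonotoneOp B) {x y z : X}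
    {b : Dual' X} {r K t : ℝ}
    (hloc : ∀ w, ‖w - x‖ < r → w ∈ domOp B ∧ ∀ v ∈ B w, ‖v‖ ≤ K) (ht0 : 0 < t) (ht1 : t ≤ 1)
    (hy : ‖y - z - t • (x - z)‖ < t * r) (hb : b ∈ B y) : b (y - z) ≤ K * ‖y - z‖ := by
  set e := y - z - t • (x - z) with he
  set x' := x + t⁻¹ • e with hx'
  have hx'x : ‖x' - x‖ < r := by
    rwa [hx', add_sub_cancel_left, norm_smul, norm_inv, Real.norm_of_nonneg ht0.le,
      inv_mul_lt_iff₀ ht0]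
  have hbound : ∀ b' : Dual' X, ‖b'‖ ≤ K → b' (y - z) ≤ K * ‖y - z‖ := fun b' hb' =>
    (le_abs_self _).trans
      ((b'.le_opNorm _).trans (mul_le_mul_of_nonneg_right hb' (norm_nonneg _)))
  have hxy : t • (x' - y) = (1 - t) • (y - z) := by
    have h : t • x' = t • x + e := by rw [hx', smul_add, smul_inv_smul₀ ht0.ne']
    rw [smul_sub, h, he]
    module
  rcases ht1.eq_or_lt with h1 | h1
  · have hxy' : x' = y := by
      rw [h1, sub_self, zero_smul, one_smul] at hxy
      exact sub_eq_zero.1 hxy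
    exact hbound b ((hloc y (hxy' ▸ hx'x)).2 b hb)
  · obtain ⟨⟨b', hb'⟩, hK⟩ := hloc x' hx'x
    refine le_trans ?_ (hbound b' (hK b' hb'))
    have h2 := mul_nonneg ht0.le (hB x' y b' b hb' hb)
    rw [← smul_eq_mul, ← map_smul, hxy, map_smul, smul_eq_mul, sub_apply] at h2
    have h3 : 0 ≤ b' (y - z) - b (y - z) := le_of_mul_le_mul_left
      (by rwa [mul_zero]) (sub_pos.2 h1)
    linarith

variable [CompleteSpace X] {B : X → Set (Dual' X)} {Q : Set X} {g : X → ℝ} {x z : X}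

/-- Points of `Q` that are optimal for the penalized problem `g + h` over `cl (dom B)`: the
penalty has a subgradient `k` at such a point with `-k` a subgradient of `g + ι_{cl (dom B)}`, and
monotone relatedness to `∂g + B` passes to `k`. -/
lemma exists_penalized_point (hg : ConvexOn ℝ Q g)
    (hcl : IsClosed {p : X × ℝ | p.1 ∈ Q ∧ g p.1 ≤ p.2}) (hB : MaxMonotone B)
    (hsub : ∀ y ∈ Q, y ∈ closure (domOp B) →
      (∃ a : Dual' X, ∀ w ∈ Q, g y + a (w - y) ≤ g w) → y ∈ domOp B)
    (hz : ∀ y ∈ Q, ∀ a : Dual' X, (∀ w ∈ Q, g y + a (w - y) ≤ g w) → ∀ b ∈ B y,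
      0 ≤ (a + b) (y - z))
    (hx : x ∈ Q) (hx' : x ∈ interior (domOp B)) {h : X → ℝ} (hh : ConvexOn ℝ univ h)
    (hhc : Continuous h) {m : ℝ} (hm : ∀ w ∈ Q, m ≤ g w + h w) :
    ∃ y ∈ Q, y ∈ domOp B ∧ g y + h y ≤ g x + h x ∧ ∃ k : Dual' X,
      (∀ w, h y + k (w - y) ≤ h w + ‖w - y‖) ∧
      (∀ w ∈ Q, w ∈ domOp B → g y ≤ g w + k (w - y)) ∧ ∀ b ∈ B y, k (y - z) ≤ b (y - z) := by
  have hint : (interior (domOp B)).Nonempty := ⟨x, hx'⟩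
  have hx'' := interior_mono subset_closure hx'
  have hcl' : IsClosed {p : X × ℝ | p.1 ∈ Q ∩ closure (domOp B) ∧ g p.1 + h p.1 ≤ p.2} := by
    have h1 : IsClosed ((fun p : X × ℝ => (p.1, p.2 - h p.1)) ⁻¹'
        {p : X × ℝ | p.1 ∈ Q ∧ g p.1 ≤ p.2}) := hcl.preimage (by fun_prop)
    convert h1.inter (isClosed_closure.preimage continuous_fst :
      IsClosed (Prod.fst ⁻¹' closure (domOp B) : Set (X × ℝ))) using 1
    ext p
    simp only [mem_inter_iff, mem_preimage, mem_ofPred_eq, le_sub_iff_add_le]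
    tauto
  obtain ⟨y, hy, hyx, hmin⟩ := ekeland (fun w hw => hm w hw.1) hcl'
    (x := x) ⟨hx, interior_subset hx''⟩
  have hnorm : ConvexOn ℝ univ fun w : X => ‖w - y‖ := by
    simpa [Function.comp_def, sub_eq_add_neg] using
      (convexOn_univ_norm (E := X)).translate_left (-y)
  obtain ⟨a, c, ha, hc, hk⟩ := exists_subgradient_sum hg (hB.convex_closure_domOp hint)
    (hh.add hnorm) (hhc.add (by fun_prop)) hx hx'' hy.1 hy.2 fun w hw hwC => by
      have := hmin w ⟨hw, hwC⟩
      simp only [Pi.add_apply, sub_self, norm_zero]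
      linarith
  refine ⟨y, hy.1, hsub y hy.1 hy.2 ⟨a, ha⟩, hyx, -(a + c), fun w => ?_, fun w hw hwB => ?_,
    fun b hb => ?_⟩
  · have := hk w
    simp only [Pi.add_apply, sub_self, norm_zero] at this
    rw [neg_apply]
    linarith
  · have h1 := ha w hw
    have h2 := hc w (subset_closure hwB)
    rw [neg_apply, add_apply]
    linarith
  · have := hz y hy.1 a ha _ (hB.add_mem hb hc)
    simp only [add_apply, neg_apply] at *
    linarith

lemma exists_near_segment (hg : ConvexOn ℝ Q g)
    (hcl : IsClosed {p : X × ℝ | p.1 ∈ Q ∧ g p.1 ≤ p.2}) (hB : MaxMonotone B)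
    (hsub : ∀ y ∈ Q, y ∈ closure (domOp B) →
      (∃ a : Dual' X, ∀ w ∈ Q, g y + a (w - y) ≤ g w) → y ∈ domOp B)
    (hz : ∀ y ∈ Q, ∀ a : Dual' X, (∀ w ∈ Q, g y + a (w - y) ≤ g w) → ∀ b ∈ B y,
      0 ≤ (a + b) (y - z))
    (hx : x ∈ Q) (hx' : x ∈ interior (domOp B)) {τ ρ : ℝ} (hτ0 : 0 < τ) (hτ1 : τ < 1)
    (hρ : 0 < ρ) :
    ∃ y ∈ Q, ‖y - (z + τ • (x - z))‖ < ρ ∧ ∃ b ∈ B y,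
      g y ≤ g x + b (x - y + τ⁻¹ • (y - (z + τ • (x - z)))) := by
  obtain ⟨r₀, K, hr₀, hK0, hK⟩ :=
    locally_bounded (interior_mono (hB.1.domOp_subset z) hx')
  obtain ⟨r₁, hr₁, hball⟩ := Metric.mem_nhds_iff.1 (mem_interior_iff_mem_nhds.1 hx')
  set r := min r₀ r₁ with hr
  have hrpos : 0 < r := lt_min hr₀ hr₁
  have hloc : ∀ w, ‖w - x‖ < r → w ∈ domOp B ∧ ∀ v ∈ B w, ‖v‖ ≤ K := fun w hw =>
    ⟨hball (mem_ball_iff_norm.2 (hw.trans_le (min_le_right _ _))),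
      hK w (hw.trans_le (min_le_left _ _))⟩
  obtain ⟨α, β, hαβ⟩ := exists_affine_minorant hg hcl ⟨x, hx⟩
  set d := x - z with hd
  set p := z + τ • d with hp
  set v := (1 - τ) • d with hv
  have hxpv : x = p + v := by rw [hp, hv, hd]; module
  set M := ‖v‖ + (K * (‖d‖ + 1) + 1) / τ with hM
  have hMv : ‖v‖ ≤ M := by
    have : 0 ≤ (K * (‖d‖ + 1) + 1) / τ := by positivity
    linarith
  have hM0 : 0 ≤ M := (norm_nonneg v).trans hMv
  set A := g x + M - (α p - |α v| + β) with hA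
  set δ := min (min ρ (τ * r)) 1 with hδ
  have hδ0 : 0 < δ := lt_min (lt_min hρ (mul_pos hτ0 hrpos)) one_pos
  set n := ‖α‖ + 2 + |A| / δ with hn
  have hAδ : 0 ≤ |A| / δ := by positivity
  have hn0 : 0 ≤ n := by positivity
  clear_value n δ A M v p d r
  obtain ⟨h, hle, heq, hconv, hcont⟩ := exists_segment_penalty p v hn0 M
  have hlow : ∀ w ∈ Q, ∀ l ∈ Icc (0 : ℝ) 1,
      α p - |α v| + β - ‖α‖ * ‖w - p - l • v‖ ≤ g w := by
    intro w hw l hl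
    have h1 := hαβ w hw
    have h2 := neg_le_of_abs_le (α.le_opNorm (w - p - l • v))
    simp only [map_sub, map_smul, smul_eq_mul] at h2
    have h3 : -|α v| ≤ l * α v := by
      have := neg_abs_le (α v)
      have := mul_le_mul_of_nonneg_left this hl.1
      nlinarith [abs_nonneg (α v), hl.2]
    linarith
  obtain ⟨y, hyQ, hyB, hyx, k, hk, hkg, hkB⟩ := exists_penalized_point hg hcl hB hsub hz hx hx'
    hconv hcont (m := α p - |α v| + β) fun w hw => by
      obtain ⟨l, hl, hwl⟩ := heq w
      have h1 := hlow w hw l hl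
      have h2 := mul_nonneg hM0 hl.1
      have h3 : 0 ≤ (2 + |A| / δ) * ‖w - p - l • v‖ := by positivity
      rw [hwl, hn]
      linarith
  obtain ⟨l, hl, hyl⟩ := heq y
  set e := y - p - l • v with he
  have hye : y = p + l • v + e := by rw [he]; abel
  have hhx : h x ≤ M := by
    have := hle x 1 (by simp)
    rwa [show x - p - (1 : ℝ) • v = 0 by rw [hxpv]; module, norm_zero, mul_zero, zero_add,
      mul_one] at this
  have heδ : ‖e‖ < δ := by
    by_contra! hle'
    have h1 := hlow y hyQ l hl
    rw [← he] at h1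
    have h2 := mul_nonneg hM0 hl.1
    have h3 : |A| / δ * δ ≤ |A| / δ * ‖e‖ := mul_le_mul_of_nonneg_left hle' hAδ
    rw [div_mul_cancel₀ _ hδ0.ne'] at h3
    have h4 := le_abs_self A
    rw [hyl, hn] at hyx
    linarith
  have heρ : ‖e‖ < ρ := heδ.trans_le (hδ.le.trans ((min_le_left _ _).trans (min_le_left _ _)))
  have her : ‖e‖ < τ * r := heδ.trans_le (hδ.le.trans ((min_le_left _ _).trans (min_le_right _ _)))
  have he1 : ‖e‖ < 1 := heδ.trans_le (hδ.le.trans (min_le_right _ _))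
  have hke : 0 ≤ k e := by
    have h1 := hk (y - e)
    have h2 := hle (y - e) l hl
    rw [show y - e - p - l • v = 0 by rw [he]; abel, norm_zero] at h2
    rw [show y - e - y = -e by abel, norm_neg, map_neg, hyl] at h1
    have h3 : 0 ≤ (‖α‖ + 1 + |A| / δ) * ‖e‖ := by positivity
    rw [hn] at h1
    linarith
  have hkv : l * (M - ‖v‖) ≤ l * k v := by
    have h1 := hk (y - l • v)
    have h2 := hle (y - l • v) 0 (by simp)
    rw [show y - l • v - p - (0 : ℝ) • v = e by rw [he]; module] at h2
    rw [show y - l • v - y = -(l • v) by abel, norm_neg, map_neg, hyl, norm_smul,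
      Real.norm_of_nonneg hl.1, map_smul, smul_eq_mul] at h1
    linarith
  obtain ⟨b, hb⟩ := hyB
  have hl0 : l = 0 := by
    by_contra hne
    have hlpos : 0 < l := lt_of_le_of_ne hl.1 (Ne.symm hne)
    set t := τ + l * (1 - τ) with ht
    have hτt : τ ≤ t := by nlinarith
    have ht0 : 0 < t := hτ0.trans_le hτt
    have ht1 : t ≤ 1 := by nlinarith [hl.2]
    have hyz : y - z = t • d + e := by rw [hye, hp, hv, ht]; module
    have h1 : (K * (‖d‖ + 1) + 1) / τ ≤ k v := by
      have := le_of_mul_le_mul_left hkv hlpos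
      linarith
    have h2 : K * (‖d‖ + 1) + 1 ≤ k (y - z) := by
      rw [div_le_iff₀ hτ0, hv, map_smul, smul_eq_mul] at h1
      have h3 : 0 < K * (‖d‖ + 1) + 1 := by positivity
      have h4 : 0 < k d := by
        by_contra! hneg
        have : (1 - τ) * k d ≤ 0 := mul_nonpos_of_nonneg_of_nonpos (by linarith) hneg
        nlinarith
      rw [hyz, map_add, map_smul, smul_eq_mul]
      nlinarith [mul_pos hτ0 h4]
    have hnorm : ‖y - z‖ ≤ ‖d‖ + 1 := by
      rw [hyz]
      refine (norm_add_le _ _).trans (add_le_add ?_ he1.le)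
      rw [norm_smul, Real.norm_of_nonneg ht0.le]
      exact mul_le_of_le_one_left (norm_nonneg d) ht1
    have hbK : b (y - z) ≤ K * (‖d‖ + 1) := by
      refine (hB.1.apply_le_of_near_segment hloc ht0 ht1 ?_ hb).trans
        (mul_le_mul_of_nonneg_left hnorm hK0)
      rw [hyz, ← hd, add_sub_cancel_left]
      exact her.trans_le (mul_le_mul_of_nonneg_right hτt hrpos.le)
    linarith [hkB b hb]
  have hep : e = y - p := by rw [he, hl0, zero_smul, sub_zero]
  rw [hep] at heρ hke
  refine ⟨y, hyQ, heρ, b, hb, ?_⟩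
  have h1 := hkg x hx (interior_subset hx')
  have h2 := hkB b hb
  have h3 : x - y + τ⁻¹ • (y - p) = (τ⁻¹ - 1) • (y - z) := by
    have : τ⁻¹ • p = τ⁻¹ • z + d := by rw [hp, smul_add, inv_smul_smul₀ hτ0.ne']
    rw [smul_sub, this, hd]
    module
  have h4 : k (x - y) ≤ k (x - y + τ⁻¹ • (y - p)) := by
    rw [map_add, map_smul, smul_eq_mul]
    have := mul_nonneg (inv_nonneg.2 hτ0.le) hke
    linarith
  have h5 : k (x - y + τ⁻¹ • (y - p)) ≤ b (x - y + τ⁻¹ • (y - p)) := by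
    rw [h3, map_smul, map_smul, smul_eq_mul, smul_eq_mul]
    exact mul_le_mul_of_nonneg_left h2 (sub_nonneg.2 ((one_le_inv₀ hτ0).2 hτ1.le))
  linarith

lemma le_sub_of_mem_fitzHypo (hg : ConvexOn ℝ Q g)
    (hcl : IsClosed {p : X × ℝ | p.1 ∈ Q ∧ g p.1 ≤ p.2}) (hB : MaxMonotone B)
    (hsub : ∀ y ∈ Q, y ∈ closure (domOp B) →
      (∃ a : Dual' X, ∀ w ∈ Q, g y + a (w - y) ≤ g w) → y ∈ domOp B)
    (hz : ∀ y ∈ Q, ∀ a : Dual' X, (∀ w ∈ Q, g y + a (w - y) ≤ g w) → ∀ b ∈ B y,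
      0 ≤ (a + b) (y - z))
    (hx : x ∈ Q) (hx' : x ∈ interior (domOp B)) {s : ℝ} (hs : (x, s) ∈ fitzHypo B z) :
    z ∈ Q ∧ g z ≤ g x - s := by
  have hint : (interior (domOp B)).Nonempty := ⟨x, hx'⟩
  have hnear := fun {τ ρ : ℝ} => exists_near_segment (τ := τ) (ρ := ρ) hg hcl hB hsub hz hx hx'
  have hclos : ∀ τ : ℝ, 0 < τ → τ < 1 → z + τ • (x - z) ∈ closure (domOp B) :=
    fun τ hτ0 hτ1 => Metric.mem_closure_iff.2 fun ε hε => by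
      obtain ⟨y, -, hy, b, hb, -⟩ := hnear hτ0 hτ1 hε
      exact ⟨y, ⟨b, hb⟩, by rwa [dist_comm, dist_eq_norm]⟩
  obtain ⟨u, hu⟩ := hs
  have hseg : ∀ τ : ℝ, 0 < τ → τ < 1 →
      z + τ • (x - z) ∈ Q ∧ g (z + τ • (x - z)) ≤ g x - s - τ * u (x - z) := by
    intro τ hτ0 hτ1
    set p := z + τ • (x - z) with hp
    have hpint : p ∈ interior (Prod.fst '' fitzHypo B z) := by
      rw [← hB.interior_closure_domOp hint z]
      have h1 := (hB.convex_closure_domOp hint).combo_interior_closure_mem_interior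
        (interior_mono subset_closure hx')
        (subset_closure (hclos (τ / 2) (by linarith) (by linarith)))
        (a := (τ / 2) / (1 - τ / 2)) (b := 1 - (τ / 2) / (1 - τ / 2))
        (div_pos (by linarith) (by linarith))
        (by rw [sub_nonneg, div_le_one (by linarith)]; linarith) (by ring)
      convert h1 using 1
      have h2 : (τ / 2) / (1 - τ / 2) * (1 - τ / 2) = τ / 2 :=
        div_mul_cancel₀ _ (by linarith)
      set c := (τ / 2) / (1 - τ / 2) with hc
      have h3 : τ = c + (1 - c) * (τ / 2) := by linarith
      rw [hp]
      nth_rewrite 1 [h3]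
      module
    obtain ⟨r, K, hr, hK0, hK⟩ := locally_bounded hpint
    refine mem_and_le_of_forall_near hcl fun ε hε => ?_
    obtain ⟨ρ, hρ, hρ1, -⟩ := exists_small_bound (‖u‖ + τ⁻¹ * K) 0 hε
    obtain ⟨y, hyQ, hyp, b, hb, hgy⟩ := hnear hτ0 hτ1 (lt_min hε (lt_min hr hρ))
    refine ⟨y, hyQ, hyp.trans_le (min_le_left _ _), ?_⟩
    have hbK := hK y (hyp.trans_le ((min_le_right _ _).trans (min_le_left _ _))) b hb
    have hyρ := hyp.trans_le ((min_le_right _ _).trans (min_le_right _ _))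
    have h1 := hu y b hb
    have h2 : b (y - p) ≤ K * ‖y - p‖ := (le_abs_self _).trans
      ((b.le_opNorm _).trans (mul_le_mul_of_nonneg_right hbK (norm_nonneg _)))
    have h3 := neg_le_of_abs_le (u.le_opNorm (y - p))
    have h4 : τ⁻¹ * b (y - p) ≤ τ⁻¹ * (K * ‖y - p‖) :=
      mul_le_mul_of_nonneg_left h2 (by positivity)
    have h5 : u (z - y) = -(τ * u (x - z)) - u (y - p) := by
      rw [show z - y = -(τ • (x - z)) - (y - p) by rw [hp]; abel]
      simp only [map_sub, map_neg, map_smul, smul_eq_mul]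
    have h6 : (‖u‖ + τ⁻¹ * K) * ‖y - p‖ ≤ (‖u‖ + τ⁻¹ * K) * ρ :=
      mul_le_mul_of_nonneg_left hyρ.le (by positivity)
    rw [abs_of_nonneg (by positivity)] at hρ1
    rw [map_add, map_smul, smul_eq_mul] at hgy
    simp only at h1
    linarith
  refine mem_and_le_of_forall_near hcl fun ε hε => ?_
  obtain ⟨ρ, hρ, hρ1, hρ2⟩ := exists_small_bound ‖x - z‖ (u (x - z)) hε
  set τ := min ρ (1 / 2) with hτ
  have hτ0 : 0 < τ := lt_min hρ (by norm_num)
  obtain ⟨h1, h2⟩ := hseg τ hτ0 ((min_le_right _ _).trans_lt (by norm_num))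
  refine ⟨_, h1, ?_, ?_⟩
  · rw [add_sub_cancel_left, norm_smul, Real.norm_of_nonneg hτ0.le]
    rw [abs_of_nonneg (norm_nonneg _)] at hρ1
    exact (mul_le_mul_of_nonneg_right (min_le_left _ _) (norm_nonneg _)).trans_lt hρ1
  · have h3 := mul_le_mul_of_nonneg_left (neg_abs_le (u (x - z))) hτ0.le
    have h4 := mul_le_mul_of_nonneg_right (min_le_left ρ (1 / 2)) (abs_nonneg (u (x - z)))
    rw [← hτ] at h4
    linarith

/-- A point that is monotonically related, together with the zero functional, to `∂g + B` is a
zero of `∂g + B`. -/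
lemma exists_subgradient_neg_mem (hg : ConvexOn ℝ Q g)
    (hcl : IsClosed {p : X × ℝ | p.1 ∈ Q ∧ g p.1 ≤ p.2}) (hB : MaxMonotone B)
    (hsub : ∀ y ∈ Q, y ∈ closure (domOp B) →
      (∃ a : Dual' X, ∀ w ∈ Q, g y + a (w - y) ≤ g w) → y ∈ domOp B)
    (hz : ∀ y ∈ Q, ∀ a : Dual' X, (∀ w ∈ Q, g y + a (w - y) ≤ g w) → ∀ b ∈ B y,
      0 ≤ (a + b) (y - z))
    (hx : x ∈ Q) (hx' : x ∈ interior (domOp B)) :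
    z ∈ Q ∧ ∃ a : Dual' X, (∀ w ∈ Q, g z + a (w - z) ≤ g w) ∧ -a ∈ B z := by
  have hint : (interior (domOp B)).Nonempty := ⟨x, hx'⟩
  have hkey := fun {x s} (hx : x ∈ Q) (hx' : x ∈ interior (domOp B)) =>
    le_sub_of_mem_fitzHypo (x := x) (s := s) hg hcl hB hsub hz hx hx'
  obtain ⟨b, hb⟩ := interior_subset hx'
  obtain ⟨hzQ, -⟩ := hkey hx hx' (hB.1.mem_fitzHypo hb z)
  have hconv : ConvexOn ℝ Q fun w => g w - g z := hg.sub (concaveOn_const (g z) hg.1)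
  obtain ⟨a, c, h1, h2⟩ := exists_affine_between hconv.convex_epigraph
    (convex_fitzHypo B z) (fun _ _ _ h => fitzHypo_down h)
    (hB.1.interior_fitzHypo_nonempty hint z)
    (Set.disjoint_left.2 fun q hq hq' => by
      obtain ⟨ε, hε, h⟩ := exists_pos_mem_of_mem_interior hq
      have hqi : q.1 ∈ interior (domOp B) := interior_maximal
        (hB.interior_subset_domOp hint z) isOpen_interior
        (isOpenMap_fst.image_interior_subset _ (mem_image_of_mem _ hq))
      have h3 := (hkey hq'.1 hqi h).2
      have h4 := hq'.2
      linarith)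
    (p := (x, g x - g z)) ⟨hx, le_rfl⟩ (interior_mono (hB.1.domOp_subset z) hx')
  have h3 := h1 (z, g z - g z) ⟨hzQ, le_rfl⟩
  simp only [sub_self] at h3
  have h4 := hB.neg_mem h3 h2
  have h5 := h2 _ (hB.1.mem_fitzHypo h4 z)
  simp only [sub_self, map_zero] at h5
  refine ⟨hzQ, a, fun w hw => ?_, h4⟩
  have h6 := h1 (w, g w - g z) ⟨hw, le_rfl⟩
  simp only [map_sub] at *
  linarith

end Core

lemma ProperFun.coe_toReal {f : X → EReal} (hf : ProperFun f) {x : X} (hx : x ∈ domFun f) :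
    ((f x).toReal : EReal) = f x := EReal.coe_toReal hx (hf.1 x)

lemma ProperFun.isClosed_epigraph_toReal [TopologicalSpace X] {f : X → EReal}
    (hf : ProperFun f) (hlsc : LowerSemicontinuous f) :
    IsClosed {p : X × ℝ | p.1 ∈ domFun f ∧ (f p.1).toReal ≤ p.2} := by
  have h : IsClosed ((fun p : X × ℝ => (p.1, (p.2 : EReal))) ⁻¹' {p | f p.1 ≤ p.2}) :=
    hlsc.isClosed_epigraph.preimage
      (continuous_fst.prodMk (continuous_coe_real_ereal.comp continuous_snd))
  convert h using 1
  ext p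
  constructor
  · rintro ⟨h1, h2⟩
    change f p.1 ≤ p.2
    rw [← hf.coe_toReal h1]
    exact_mod_cast h2
  · intro h1
    change f p.1 ≤ p.2 at h1
    have h2 : p.1 ∈ domFun f := (h1.trans_lt (EReal.coe_lt_top _)).ne
    rw [← hf.coe_toReal h2] at h1
    exact ⟨h2, by exact_mod_cast h1⟩

section ExtendedReal
variable [NormedAddCommGroup X] [NormedSpace ℝ X] {f : X → EReal}

lemma ProperFun.convexOn_toReal (hf : ProperFun f) (hconv : EConvexOn f) :
    ConvexOn ℝ (domFun f) fun x => (f x).toReal := by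
  have key : ∀ x ∈ domFun f, ∀ y ∈ domFun f, ∀ α β : ℝ, 0 ≤ α → 0 ≤ β → α + β = 1 →
      f (α • x + β • y) ≤ ((α * (f x).toReal + β * (f y).toReal : ℝ) : EReal) := by
    intro x hx y hy α β hα hβ hαβ
    obtain rfl : β = 1 - α := by linarith
    have := hconv x y α hα (by linarith)
    rw [← hf.coe_toReal hx, ← hf.coe_toReal hy] at this
    exact_mod_cast this
  have hmem : Convex ℝ (domFun f) := fun x hx y hy α β hα hβ hαβ =>
    ((key x hx y hy α β hα hβ hαβ).trans_lt (EReal.coe_lt_top _)).ne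
  refine ⟨hmem, fun x hx y hy α β hα hβ hαβ => ?_⟩
  have := key x hx y hy α β hα hβ hαβ
  rw [← hf.coe_toReal (hmem hx hy hα hβ hαβ)] at this
  exact_mod_cast this

lemma ProperFun.mem_subdiff_iff (hf : ProperFun f) {y : X} {a : Dual' X} :
    a ∈ subdiff f y ↔
      y ∈ domFun f ∧ ∀ w ∈ domFun f, (f y).toReal + a (w - y) ≤ (f w).toReal := by
  constructor
  · intro h
    have hy : y ∈ domFun f := by
      obtain ⟨x, hx⟩ := hf.2
      intro hy
      have := h x
      rw [hy, EReal.coe_add_top, top_le_iff] at this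
      exact hx this
    refine ⟨hy, fun w hw => ?_⟩
    have := h w
    rw [← hf.coe_toReal hy, ← hf.coe_toReal hw, add_comm] at this
    exact_mod_cast this
  · rintro ⟨hy, h⟩ w
    by_cases hw : w ∈ domFun f
    · rw [← hf.coe_toReal hy, ← hf.coe_toReal hw, add_comm]
      exact_mod_cast h w hw
    · rw [not_not.1 hw]
      exact le_top

lemma ProperFun.monotoneOp_subdiff (hf : ProperFun f) : MonotoneOp (subdiff f) := by
  intro x y a b ha hb
  obtain ⟨hx, ha⟩ := hf.mem_subdiff_iff.1 ha
  obtain ⟨hy, hb⟩ := hf.mem_subdiff_iff.1 hb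
  have h1 := ha y hy
  have h2 := hb x hx
  simp only [sub_apply, map_sub] at *
  linarith

lemma MonotoneOp.opSum {A B : X → Set (Dual' X)} (hA : MonotoneOp A) (hB : MonotoneOp B) :
    MonotoneOp (opSum A B) := by
  rintro x y _ _ ⟨a, ha, b, hb, rfl⟩ ⟨a', ha', b', hb', rfl⟩
  have h1 := hA x y a a' ha ha'
  have h2 := hB x y b b' hb hb'
  simp only [sub_apply, add_apply] at *
  linarith

lemma MaxMonotone.translate {B : X → Set (Dual' X)} (hB : MaxMonotone B) (u : Dual' X) :
    MaxMonotone fun y => {b | b + u ∈ B y} := by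
  refine ⟨fun x y b b' hb hb' => ?_, fun x b h => hB.2 x (b + u) fun y v hv => ?_⟩
  · simpa using hB.1 x y _ _ hb hb'
  · have := h y (v - u) (by simpa using hv)
    rwa [show b + u - v = b - (v - u) by abel]

lemma domOp_translate (B : X → Set (Dual' X)) (u : Dual' X) :
    domOp (fun y => {b | b + u ∈ B y}) = domOp B := by
  ext y
  exact ⟨fun ⟨b, hb⟩ => ⟨b + u, hb⟩, fun ⟨b, hb⟩ => ⟨b - u, by simpa using hb⟩⟩

end ExtendedReal

variable [NormedAddCommGroup X] [NormedSpace ℝ X] [CompleteSpace X]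

theorem stmt7 (f : X → EReal) (hf : ProperFun f) (hlsc : LowerSemicontinuous f)
    (hconv : EConvexOn f) (B : X → Set (Dual' X)) (hB : MaxMonotone B)
    (hint : (domFun f ∩ interior (domOp B)).Nonempty)
    (hsub : domOp (subdiff f) ∩ closure (domOp B) ⊆ domOp B) :
    MaxMonotone (opSum (subdiff f) B) := by
  refine ⟨hf.monotoneOp_subdiff.opSum hB.1, fun z z' hz => ?_⟩
  obtain ⟨x, hx, hx'⟩ := hint
  have hdom := domOp_translate B z'
  obtain ⟨hzf, a, ha, hb⟩ := exists_subgradient_neg_mem (z := z) (hf.convexOn_toReal hconv)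
    (hf.isClosed_epigraph_toReal hlsc) (hB.translate z')
    (fun y hy hyB ⟨a, ha⟩ => by
      rw [hdom] at hyB ⊢
      exact hsub ⟨⟨a, hf.mem_subdiff_iff.2 ⟨hy, ha⟩⟩, hyB⟩)
    (fun y hy a ha b hb => by
      have := hz y (a + (b + z')) (Set.add_mem_add (hf.mem_subdiff_iff.2 ⟨hy, ha⟩) hb)
      simp only [sub_apply, add_apply, map_sub] at *
      linarith)
    hx (by rwa [hdom])
  exact ⟨a, hf.mem_subdiff_iff.2 ⟨hzf, ha⟩, _, hb, by simp⟩
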